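/- Let ν be the Gaussian measure on ℝ with mean −s²/2 and variance s², where s > 0. Then for all F, K > 0, the expectation ∫_ℝ max(F·e^y − K, 0) dν(y) equals F·Φ(d₁) − K·Φ(d₂), where d₂ = (ln(F/K) − s²/2)/s, d₁ = d₂ + s, and Φ is the standard normal CDF. (This is Black's formula for the price of a European call on a forward, Proposition 2.2, with zero interest rate: the forward at exercise is f(τ,T) = F·e^Z with Z normal with mean −s²/2 and variance s².) -/

import Mathlib

open Real MeasureTheory

/-- The standard normal cumulative distribution function `Φ`. -/
noncomputable def stdNormalCDF (x : ℝ) : ℝ :=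
  ∫ t in Set.Iic x, (Real.sqrt (2 * Real.pi))⁻¹ * Real.exp (-t ^ 2 / 2)

open ProbabilityTheory in
lemma stdNormalCDF_eq_setIntegral_gaussianPDFReal (x : ℝ) :
    stdNormalCDF x = ∫ t in Set.Iic x, gaussianPDFReal 0 1 t := by
  simp [stdNormalCDF, gaussianPDFReal]

lemma setIntegral_Iic_comp_add_right {E : Type*} [NormedAddCommGroup E] [NormedSpace ℝ E]
    (f : ℝ → E) (a c : ℝ) :
    ∫ t in Set.Iic a, f (t + c) = ∫ t in Set.Iic (a + c), f t := by
  rw [← integral_indicator measurableSet_Iic, ← integral_indicator measurableSet_Iic,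
    ← integral_add_right_eq_self ((Set.Iic (a + c)).indicator f) c]
  congr 1 with t
  simp [Set.indicator_apply]

open ProbabilityTheory in
/-- Exponential tilting of the standard Gaussian density is a translation. -/
lemma gaussianPDFReal_zero_one_mul_exp (s t : ℝ) :
    gaussianPDFReal 0 1 t * Real.exp (-s ^ 2 / 2 - s * t) = gaussianPDFReal 0 1 (t + s) := by
  simp only [gaussianPDFReal, mul_assoc, ← Real.exp_add]
  congr 2
  simp only [NNReal.coe_one]
  ring_nf

open ProbabilityTheory in
lemma gaussianReal_eq_map_const_sub_mul (m s : ℝ) :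
    gaussianReal m (Real.toNNReal (s ^ 2)) =
      (gaussianReal 0 1).map (fun t ↦ m - s * t) := by
  have h : (fun t : ℝ ↦ m - s * t) = (fun t ↦ m - t) ∘ (fun t ↦ s * t) := rfl
  rw [h, ← Measure.map_map (by fun_prop) (by fun_prop), gaussianReal_map_const_mul,
    gaussianReal_map_const_sub]
  congr 1
  · simp
  · ext
    simp [sq_nonneg]

lemma le_mul_exp_sub_mul_iff {s F K : ℝ} (hs : 0 < s) (hF : 0 < F) (hK : 0 < K) (m t : ℝ) :
    K ≤ F * Real.exp (m - s * t) ↔ t ≤ (Real.log (F / K) + m) / s := by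
  rw [← div_le_iff₀' hF, ← Real.log_le_iff_le_exp (by positivity), le_div_iff₀ hs,
    Real.log_div hK.ne' hF.ne', Real.log_div hF.ne' hK.ne']
  constructor <;> intro h <;> linarith

/-- **Black's formula** (Proposition 2.2, zero interest rate): if `ν` is the Gaussian
measure on `ℝ` with mean `−s²/2` and variance `s²`, then for `F, K > 0`,
`∫ max(F·e^y − K, 0) dν(y) = F·Φ(d₁) − K·Φ(d₂)` with
`d₂ = (ln(F/K) − s²/2)/s` and `d₁ = d₂ + s`. -/
theorem black_formula_call_on_forward (s F K : ℝ) (hs : 0 < s) (hF : 0 < F) (hK : 0 < K) :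
    (∫ y, max (F * Real.exp y - K) 0
        ∂(ProbabilityTheory.gaussianReal (-s ^ 2 / 2) (Real.toNNReal (s ^ 2)))) =
      F * stdNormalCDF ((Real.log (F / K) - s ^ 2 / 2) / s + s) -
        K * stdNormalCDF ((Real.log (F / K) - s ^ 2 / 2) / s) := by
  set d := (Real.log (F / K) - s ^ 2 / 2) / s with hd
  have payoff (t : ℝ) :
      ProbabilityTheory.gaussianPDFReal 0 1 t •
          max (F * Real.exp (-s ^ 2 / 2 - s * t) - K) 0 =
        (Set.Iic d).indicator (fun t ↦ F * ProbabilityTheory.gaussianPDFReal 0 1 (t + s) -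
          K * ProbabilityTheory.gaussianPDFReal 0 1 t) t := by
    have hiff : K ≤ F * Real.exp (-s ^ 2 / 2 - s * t) ↔ t ≤ d := by
      rw [le_mul_exp_sub_mul_iff hs hF hK, hd, neg_div, ← sub_eq_add_neg]
    by_cases ht : t ≤ d
    · rw [Set.indicator_of_mem (Set.mem_Iic.mpr ht),
        max_eq_left (sub_nonneg.mpr (hiff.mpr ht)), ← gaussianPDFReal_zero_one_mul_exp,
        smul_eq_mul]
      ring
    · rw [Set.indicator_of_notMem (by simpa using ht),
        max_eq_right (sub_nonpos.mpr (not_le.mp (mt hiff.mp ht)).le), smul_zero]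
  have hint := ProbabilityTheory.integrable_gaussianPDFReal 0 1
  rw [gaussianReal_eq_map_const_sub_mul, integral_map (by fun_prop) (by fun_prop),
    ProbabilityTheory.integral_gaussianReal_eq_integral_smul one_ne_zero]
  simp_rw [payoff]
  rw [integral_indicator measurableSet_Iic,
    integral_sub ((hint.comp_add_right s).const_mul F).integrableOn
      (hint.const_mul K).integrableOn,
    integral_const_mul, integral_const_mul, setIntegral_Iic_comp_add_right,
    stdNormalCDF_eq_setIntegral_gaussianPDFReal, stdNormalCDF_eq_setIntegral_gaussianPDFReal]
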